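/- A smooth function Φ : ℝⁿ → ℂ has temperate growth (Φ ∈ O_M(ℝⁿ)) if and only if for every multi-index β ∈ ℕ₀ⁿ there exists a natural number α such that the Lebesgue integral ∫_{ℝⁿ} (1+|x|²)^{−α/2} |∂^β Φ(x)| dx is finite. -/

import Mathlib

open MeasureTheory Filter

noncomputable def pd {n : ℕ} (i : Fin n) (f : EuclideanSpace ℝ (Fin n) → ℂ) :
    EuclideanSpace ℝ (Fin n) → ℂ :=
  fun x => fderiv ℝ f x (EuclideanSpace.single i 1)

/-- The multi-index partial derivative `∂^β f` for a multi-index `β ∈ ℕ₀ⁿ`. -/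
noncomputable def mderiv {n : ℕ} (β : Fin n → ℕ) (f : EuclideanSpace ℝ (Fin n) → ℂ) :
    EuclideanSpace ℝ (Fin n) → ℂ :=
  ((List.finRange n).foldr (fun i g => (pd i)^[β i] ∘ g) id) f

open scoped ENNReal

section PartialDerivatives

variable {n : ℕ} {f : EuclideanSpace ℝ (Fin n) → ℂ}

theorem contDiff_pd (i : Fin n) (hf : ContDiff ℝ (⊤ : ℕ∞) f) : ContDiff ℝ (⊤ : ℕ∞) (pd i f) :=
  (hf.fderiv_right (m := (⊤ : ℕ∞)) (by simp)).clm_apply contDiff_const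

theorem contDiff_iterate_pd (i : Fin n) (k : ℕ) (hf : ContDiff ℝ (⊤ : ℕ∞) f) :
    ContDiff ℝ (⊤ : ℕ∞) ((pd i)^[k] f) := by
  induction k with
  | zero => exact hf
  | succ k ih => rw [Function.iterate_succ_apply']; exact contDiff_pd i ih

theorem pd_comm (i j : Fin n) (hf : ContDiff ℝ (⊤ : ℕ∞) f) :
    pd i (pd j f) = pd j (pd i f) := by
  have hd : Differentiable ℝ (fderiv ℝ f) :=
    (hf.fderiv_right (m := (⊤ : ℕ∞)) (by simp)).differentiable (by simp)
  have key (k l : Fin n) (x : EuclideanSpace ℝ (Fin n)) : pd k (pd l f) x =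
      fderiv ℝ (fderiv ℝ f) x (EuclideanSpace.single k 1) (EuclideanSpace.single l 1) := by
    have h := (hd x).hasFDerivAt.clm_apply
      (hasFDerivAt_const (EuclideanSpace.single l (1 : ℝ)) x)
    have h' : fderiv ℝ (pd l f) x = _ := h.fderiv
    rw [pd, h']
    simp
  ext x
  rw [key, key]
  exact ((contDiff_infty.1 hf 2).contDiffAt.isSymmSndFDerivAt
    (by simp)) _ _

theorem pd_iterate_pd_comm (i j : Fin n) (k : ℕ) (hf : ContDiff ℝ (⊤ : ℕ∞) f) :
    pd i ((pd j)^[k] f) = (pd j)^[k] (pd i f) := by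
  induction k with
  | zero => rfl
  | succ k ih =>
    rw [Function.iterate_succ_apply', Function.iterate_succ_apply',
      pd_comm i j (contDiff_iterate_pd j k hf), ih]

theorem contDiff_foldr_pd (β : Fin n → ℕ) (l : List (Fin n)) (hf : ContDiff ℝ (⊤ : ℕ∞) f) :
    ContDiff ℝ (⊤ : ℕ∞) ((l.foldr (fun i g => (pd i)^[β i] ∘ g) id) f) := by
  induction l with
  | nil => exact hf
  | cons a l ih => exact contDiff_iterate_pd a _ ih

theorem contDiff_mderiv (β : Fin n → ℕ) (hf : ContDiff ℝ (⊤ : ℕ∞) f) :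
    ContDiff ℝ (⊤ : ℕ∞) (mderiv β f) :=
  contDiff_foldr_pd β _ hf

theorem foldr_pd_update_of_notMem (β : Fin n → ℕ) (i : Fin n) (k : ℕ) {l : List (Fin n)}
    (hl : i ∉ l) :
    (l.foldr (fun j g => (pd j)^[Function.update β i k j] ∘ g) id) f =
      (l.foldr (fun j g => (pd j)^[β j] ∘ g) id) f := by
  induction l with
  | nil => rfl
  | cons a l ih =>
    simp only [List.mem_cons, not_or] at hl
    simp only [List.foldr_cons, Function.comp_apply, ih hl.2,
      Function.update_of_ne (Ne.symm hl.1)]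

theorem pd_foldr_pd (β : Fin n → ℕ) (i : Fin n) {l : List (Fin n)} (hl : l.Nodup) (hi : i ∈ l)
    (hf : ContDiff ℝ (⊤ : ℕ∞) f) :
    pd i ((l.foldr (fun j g => (pd j)^[β j] ∘ g) id) f) =
      (l.foldr (fun j g => (pd j)^[Function.update β i (β i + 1) j] ∘ g) id) f := by
  induction l with
  | nil => simp at hi
  | cons a l ih =>
    rw [List.nodup_cons] at hl
    simp only [List.foldr_cons, Function.comp_apply]
    by_cases h : i = a
    · subst h
      rw [foldr_pd_update_of_notMem β i _ hl.1, Function.update_self,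
        Function.iterate_succ_apply']
    · rw [pd_iterate_pd_comm _ _ _ (contDiff_foldr_pd β l hf),
        ih hl.2 ((List.mem_cons.1 hi).resolve_left h), Function.update_of_ne (Ne.symm h)]

theorem pd_mderiv (β : Fin n → ℕ) (i : Fin n) (hf : ContDiff ℝ (⊤ : ℕ∞) f) :
    pd i (mderiv β f) = mderiv (Function.update β i (β i + 1)) f :=
  pd_foldr_pd β i (List.nodup_finRange n) (List.mem_finRange i) hf

end PartialDerivatives

theorem enorm_le_setLIntegral_enorm_add_enorm_deriv {γ γ' : ℝ → ℂ}
    (hγ : ∀ t, HasDerivAt γ (γ' t) t) (hγ' : Continuous γ') (a : ℝ) :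
    ‖γ a‖ₑ ≤ ∫⁻ t in Set.Icc a (a + 1), (‖γ t‖ₑ + ‖γ' t‖ₑ) := by
  have hγc : Continuous γ := continuous_iff_continuousAt.2 fun t => (hγ t).continuousAt
  have hpt : ∀ t ∈ Set.Icc a (a + 1),
      ‖γ a‖ₑ ≤ ‖γ t‖ₑ + ∫⁻ s in Set.Icc a (a + 1), ‖γ' s‖ₑ := by
    intro t ht
    have hint : ∫ s in a..t, γ' s = γ t - γ a :=
      intervalIntegral.integral_eq_sub_of_hasDerivAt (fun s _ => hγ s)
        (hγ'.intervalIntegrable a t)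
    have hle : ‖γ t - γ a‖ₑ ≤ ∫⁻ s in Set.Icc a (a + 1), ‖γ' s‖ₑ := by
      rw [← hint, intervalIntegral.integral_of_le ht.1]
      exact (enorm_integral_le_lintegral_enorm _).trans
        (lintegral_mono_set fun s hs => ⟨hs.1.le, hs.2.trans ht.2⟩)
    calc ‖γ a‖ₑ = ‖γ t - (γ t - γ a)‖ₑ := by rw [sub_sub_cancel]
      _ ≤ ‖γ t‖ₑ + ‖γ t - γ a‖ₑ := enorm_sub_le
      _ ≤ _ := by gcongr
  have hvol : volume (Set.Icc a (a + 1)) = 1 := by simp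
  calc ‖γ a‖ₑ = ∫⁻ _ in Set.Icc a (a + 1), ‖γ a‖ₑ := by
        rw [setLIntegral_const, hvol, mul_one]
    _ ≤ ∫⁻ t in Set.Icc a (a + 1), (‖γ t‖ₑ + ∫⁻ s in Set.Icc a (a + 1), ‖γ' s‖ₑ) :=
        setLIntegral_mono' measurableSet_Icc hpt
    _ = ∫⁻ t in Set.Icc a (a + 1), (‖γ t‖ₑ + ‖γ' t‖ₑ) := by
        rw [lintegral_add_right _ measurable_const, setLIntegral_const, hvol, mul_one,
          lintegral_add_left hγc.enorm.measurable]

theorem mul_enorm_le_lintegral_mul_enorm_add_enorm_deriv {γ γ' : ℝ → ℂ}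
    (hγ : ∀ t, HasDerivAt γ (γ' t) t) (hγ' : Continuous γ') (a : ℝ) {w : ℝ → ℝ≥0∞} {c : ℝ≥0∞}
    (hc : c ≠ ∞) (hw : ∀ t ∈ Set.Icc a (a + 1), w a ≤ c * w t) :
    w a * ‖γ a‖ₑ ≤ c * ∫⁻ t, w t * (‖γ t‖ₑ + ‖γ' t‖ₑ) := by
  have hγc : Continuous γ := continuous_iff_continuousAt.2 fun t => (hγ t).continuousAt
  calc w a * ‖γ a‖ₑ ≤ w a * ∫⁻ t in Set.Icc a (a + 1), (‖γ t‖ₑ + ‖γ' t‖ₑ) := by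
        gcongr
        exact enorm_le_setLIntegral_enorm_add_enorm_deriv hγ hγ' a
    _ = ∫⁻ t in Set.Icc a (a + 1), w a * (‖γ t‖ₑ + ‖γ' t‖ₑ) :=
        (lintegral_const_mul _ (hγc.enorm.add hγ'.enorm).measurable).symm
    _ ≤ ∫⁻ t in Set.Icc a (a + 1), c * (w t * (‖γ t‖ₑ + ‖γ' t‖ₑ)) := by
        refine setLIntegral_mono' measurableSet_Icc fun t ht => ?_
        rw [← mul_assoc]
        gcongr
        exact hw t ht
    _ ≤ ∫⁻ t, c * (w t * (‖γ t‖ₑ + ‖γ' t‖ₑ)) := setLIntegral_le_lintegral _ _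
    _ = _ := lintegral_const_mul' _ _ hc

/-- The weight `(1 + |x|²)^{-α/2}`, with values in `ℝ≥0∞`. -/
noncomputable def temperateWeight {E : Type*} [NormedAddCommGroup E] (α : ℕ) (x : E) : ℝ≥0∞ :=
  ENNReal.ofReal ((1 + ‖x‖ ^ 2) ^ (-(α : ℝ) / 2))

section TemperateWeight

variable {E : Type*} [NormedAddCommGroup E]

theorem continuous_one_add_norm_sq_rpow (r : ℝ) :
    Continuous fun x : E => (1 + ‖x‖ ^ 2) ^ r :=
  (by fun_prop : Continuous fun x : E => 1 + ‖x‖ ^ 2).rpow_const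
    fun x => Or.inl (by positivity)

theorem continuous_temperateWeight (α : ℕ) : Continuous (temperateWeight α : E → ℝ≥0∞) :=
  ENNReal.continuous_ofReal.comp (continuous_one_add_norm_sq_rpow _)

theorem temperateWeight_antitone {α α' : ℕ} (h : α ≤ α') (x : E) :
    temperateWeight α' x ≤ temperateWeight α x := by
  refine ENNReal.ofReal_le_ofReal (Real.rpow_le_rpow_of_exponent_le ?_ ?_)
  · nlinarith [sq_nonneg ‖x‖]
  · have : (α : ℝ) ≤ α' := by exact_mod_cast h
    linarith

theorem temperateWeight_le_of_norm_sub_le_one (α : ℕ) {x y : E} (h : ‖y - x‖ ≤ 1) :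
    temperateWeight α x ≤ ENNReal.ofReal (3 ^ ((α : ℝ) / 2)) * temperateWeight α y := by
  have hyx : ‖y‖ ≤ 1 + ‖x‖ := by linarith [norm_sub_norm_le y x]
  have hle : 1 + ‖y‖ ^ 2 ≤ 3 * (1 + ‖x‖ ^ 2) := by
    nlinarith [norm_nonneg x, norm_nonneg y, sq_nonneg (‖x‖ - 1)]
  have hx : 0 < 1 + ‖x‖ ^ 2 := by positivity
  have hy : 0 < 1 + ‖y‖ ^ 2 := by positivity
  have hpow : (1 + ‖y‖ ^ 2) ^ ((α : ℝ) / 2) ≤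
      3 ^ ((α : ℝ) / 2) * (1 + ‖x‖ ^ 2) ^ ((α : ℝ) / 2) := by
    rw [← Real.mul_rpow (by norm_num) hx.le]
    exact Real.rpow_le_rpow hy.le hle (by positivity)
  rw [temperateWeight, temperateWeight, ← ENNReal.ofReal_mul (by positivity), neg_div,
    Real.rpow_neg hx.le, Real.rpow_neg hy.le]
  refine ENNReal.ofReal_le_ofReal ?_
  rw [← div_eq_mul_inv, inv_eq_one_div, div_le_div_iff₀ (by positivity) (by positivity)]
  linarith

end TemperateWeight

theorem toLp_update {n : ℕ} (x : Fin n → ℝ) (i : Fin n) (t : ℝ) :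
    WithLp.toLp 2 (Function.update x i t) =
      WithLp.toLp 2 x + (t - x i) • EuclideanSpace.single i (1 : ℝ) := by
  ext j
  by_cases h : j = i
  · subst h; simp
  · simp [h]

theorem hasDerivAt_comp_toLp_update {n : ℕ} {f : EuclideanSpace ℝ (Fin n) → ℂ}
    (hf : Differentiable ℝ f) (x : Fin n → ℝ) (i : Fin n) (t : ℝ) :
    HasDerivAt (fun s => f (WithLp.toLp 2 (Function.update x i s)))
      (pd i f (WithLp.toLp 2 (Function.update x i t))) t := by
  have h : HasDerivAt (fun s : ℝ => WithLp.toLp 2 (Function.update x i s))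
      (EuclideanSpace.single i (1 : ℝ)) t := by
    simp_rw [toLp_update]
    simpa using (((hasDerivAt_id t).sub_const (x i)).smul_const
      (EuclideanSpace.single i (1 : ℝ))).const_add (WithLp.toLp 2 x)
  exact (hf _).hasFDerivAt.comp_hasDerivAt t h

theorem temperateWeight_mul_enorm_le_lintegral_update {n : ℕ}
    {f : EuclideanSpace ℝ (Fin n) → ℂ} (hf : ContDiff ℝ (⊤ : ℕ∞) f) (α : ℕ) (x : Fin n → ℝ)
    (i : Fin n) :
    temperateWeight α (WithLp.toLp 2 x) * ‖f (WithLp.toLp 2 x)‖ₑ ≤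
      ENNReal.ofReal (3 ^ ((α : ℝ) / 2)) * ∫⁻ t : ℝ,
        temperateWeight α (WithLp.toLp 2 (Function.update x i t)) *
          (‖f (WithLp.toLp 2 (Function.update x i t))‖ₑ +
            ‖pd i f (WithLp.toLp 2 (Function.update x i t))‖ₑ) := by
  have hcont : Continuous fun t : ℝ => pd i f (WithLp.toLp 2 (Function.update x i t)) := by
    refine (contDiff_pd i hf).continuous.comp ?_
    simp_rw [toLp_update]
    fun_prop
  have h := mul_enorm_le_lintegral_mul_enorm_add_enorm_deriv
    (hasDerivAt_comp_toLp_update (hf.differentiable (by simp)) x i) hcont (x i)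
    (w := fun t => temperateWeight α (WithLp.toLp 2 (Function.update x i t)))
    (c := ENNReal.ofReal (3 ^ ((α : ℝ) / 2))) ENNReal.ofReal_ne_top ?_
  · simpa only [Function.update_eq_self] using h
  · intro t ht
    refine temperateWeight_le_of_norm_sub_le_one α ?_
    rw [Function.update_eq_self, toLp_update, add_sub_cancel_left, norm_smul,
      PiLp.norm_single, norm_one, mul_one, Real.norm_eq_abs, abs_le]
    constructor <;> linarith [ht.1, ht.2]

/-- The marginals over the coordinates in `s` of the weighted modulus of `f` are bounded,
for some weight. -/
def HasBoundedWeightedMarginal {n : ℕ} (s : Finset (Fin n))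
    (f : EuclideanSpace ℝ (Fin n) → ℂ) : Prop :=
  ∃ α : ℕ, ∃ C : ℝ≥0∞, C ≠ ∞ ∧ ∀ x : Fin n → ℝ,
    (∫⋯∫⁻_s, (fun y => temperateWeight α (WithLp.toLp 2 y) * ‖f (WithLp.toLp 2 y)‖ₑ)
      ∂(fun _ => (volume : Measure ℝ))) x ≤ C

theorem HasBoundedWeightedMarginal.of_insert {n : ℕ} {s : Finset (Fin n)} {i : Fin n}
    (hi : i ∉ s) {f : EuclideanSpace ℝ (Fin n) → ℂ} (hf : ContDiff ℝ (⊤ : ℕ∞) f)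
    (h₁ : HasBoundedWeightedMarginal (insert i s) f)
    (h₂ : HasBoundedWeightedMarginal (insert i s) (pd i f)) :
    HasBoundedWeightedMarginal s f := by
  obtain ⟨α₁, C₁, hC₁, h₁⟩ := h₁
  obtain ⟨α₂, C₂, hC₂, h₂⟩ := h₂
  set α := max α₁ α₂
  set c := ENNReal.ofReal (3 ^ ((α : ℝ) / 2))
  refine ⟨α, c * (C₁ + C₂), ENNReal.mul_ne_top ENNReal.ofReal_ne_top
    (ENNReal.add_ne_top.2 ⟨hC₁, hC₂⟩), fun x => ?_⟩
  have htoLp : Continuous fun y : Fin n → ℝ => (WithLp.toLp 2 y : EuclideanSpace ℝ (Fin n)) :=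
    PiLp.continuous_toLp 2 _
  have hmeas {g : EuclideanSpace ℝ (Fin n) → ℂ} (hg : Continuous g) (a : ℕ) :
      Measurable fun y : Fin n → ℝ =>
        temperateWeight a (WithLp.toLp 2 y) * ‖g (WithLp.toLp 2 y)‖ₑ :=
    ((continuous_temperateWeight a).comp htoLp).measurable.mul (hg.comp htoLp).enorm.measurable
  have hf₁ := hmeas hf.continuous
  have hf₂ := hmeas (contDiff_pd i hf).continuous
  set H : (Fin n → ℝ) → ℝ≥0∞ := fun y => temperateWeight α (WithLp.toLp 2 y) *
    (‖f (WithLp.toLp 2 y)‖ₑ + ‖pd i f (WithLp.toLp 2 y)‖ₑ) with hH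
  have hHm : Measurable H := by
    simp only [hH, mul_add]
    exact (hf₁ α).add (hf₂ α)
  calc _ ≤ (∫⋯∫⁻_s, (fun y => c * ∫⁻ t : ℝ, H (Function.update y i t))
          ∂(fun _ => (volume : Measure ℝ))) x :=
        lmarginal_mono (fun y => temperateWeight_mul_enorm_le_lintegral_update hf α y i) x
    _ = c * (∫⋯∫⁻_insert i s, H ∂(fun _ => (volume : Measure ℝ))) x := by
        rw [lmarginal_insert' H hHm hi]
        exact lintegral_const_mul' _ _ ENNReal.ofReal_ne_top
    _ ≤ c * ((∫⋯∫⁻_insert i s, (fun y => temperateWeight α₁ (WithLp.toLp 2 y) *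
            ‖f (WithLp.toLp 2 y)‖ₑ) ∂(fun _ => (volume : Measure ℝ))) x +
          (∫⋯∫⁻_insert i s, (fun y => temperateWeight α₂ (WithLp.toLp 2 y) *
            ‖pd i f (WithLp.toLp 2 y)‖ₑ) ∂(fun _ => (volume : Measure ℝ))) x) := by
        gcongr
        simp only [lmarginal]
        refine le_of_le_of_eq ?_ (lintegral_add_left ((hf₁ α₁).comp measurable_updateFinset) _)
        refine lintegral_mono fun z => ?_
        simp only [hH, mul_add]
        exact add_le_add
          (mul_le_mul' (temperateWeight_antitone (le_max_left _ _) _) le_rfl)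
          (mul_le_mul' (temperateWeight_antitone (le_max_right _ _) _) le_rfl)
    _ ≤ c * (C₁ + C₂) := by
        gcongr
        · exact h₁ x
        · exact h₂ x

theorem HasBoundedWeightedMarginal.empty_of_univ {n : ℕ}
    {F : Set (EuclideanSpace ℝ (Fin n) → ℂ)} (hF : ∀ f ∈ F, ContDiff ℝ (⊤ : ℕ∞) f)
    (hpd : ∀ f ∈ F, ∀ i, pd i f ∈ F)
    (h : ∀ f ∈ F, HasBoundedWeightedMarginal Finset.univ f) :
    ∀ f ∈ F, HasBoundedWeightedMarginal ∅ f := by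
  suffices H : ∀ s : Finset (Fin n), (∀ f ∈ F, HasBoundedWeightedMarginal s f) →
      ∀ f ∈ F, HasBoundedWeightedMarginal ∅ f from H _ h
  intro s
  induction s using Finset.induction_on with
  | empty => exact id
  | insert i s hi ih =>
    exact fun hs => ih fun f hf => .of_insert hi (hF f hf) (hs f hf) (hs _ (hpd f hf i))

theorem hasBoundedWeightedMarginal_univ {n : ℕ} {f : EuclideanSpace ℝ (Fin n) → ℂ} {α : ℕ}
    (h : Integrable fun x : EuclideanSpace ℝ (Fin n) =>
      (1 + ‖x‖ ^ 2) ^ (-(α : ℝ) / 2) * ‖f x‖) :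
    HasBoundedWeightedMarginal Finset.univ f := by
  refine ⟨α, _, h.lintegral_lt_top.ne, fun x => le_of_eq ?_⟩
  rw [lmarginal_univ, ← volume_pi, ← (PiLp.volume_preserving_toLp (Fin n)).lintegral_comp_emb
    (MeasurableEquiv.toLp 2 (Fin n → ℝ)).measurableEmbedding]
  refine lintegral_congr fun y => ?_
  rw [ENNReal.ofReal_mul (by positivity), ofReal_norm, temperateWeight]

theorem HasBoundedWeightedMarginal.exists_norm_le {n : ℕ} {f : EuclideanSpace ℝ (Fin n) → ℂ}
    (h : HasBoundedWeightedMarginal ∅ f) :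
    ∃ (α : ℕ) (C : ℝ), ∀ x, ‖f x‖ ≤ C * (1 + ‖x‖ ^ 2) ^ ((α : ℝ) / 2) := by
  obtain ⟨α, C, hC, h⟩ := h
  refine ⟨α, C.toReal, fun x => ?_⟩
  have hx : 0 < 1 + ‖x‖ ^ 2 := by positivity
  have hle : temperateWeight α x * ‖f x‖ₑ ≤ C := by
    simpa only [lmarginal_empty, WithLp.toLp_ofLp] using h x.ofLp
  rw [temperateWeight, ← ofReal_norm, ← ENNReal.ofReal_mul (by positivity),
    ENNReal.ofReal_le_iff_le_toReal hC, neg_div, Real.rpow_neg hx.le, inv_mul_eq_div,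
    div_le_iff₀ (by positivity)] at hle
  exact hle

theorem exists_integrable_of_norm_le {n : ℕ} {f : EuclideanSpace ℝ (Fin n) → ℂ}
    (hf : Continuous f) {α : ℕ} {C : ℝ}
    (h : ∀ x, ‖f x‖ ≤ C * (1 + ‖x‖ ^ 2) ^ ((α : ℝ) / 2)) :
    Integrable fun x : EuclideanSpace ℝ (Fin n) =>
      (1 + ‖x‖ ^ 2) ^ (-((α + (n + 1) : ℕ) : ℝ) / 2) * ‖f x‖ := by
  have hint : Integrable fun x : EuclideanSpace ℝ (Fin n) =>
      (1 + ‖x‖ ^ 2) ^ (-((n + 1 : ℕ) : ℝ) / 2) :=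
    integrable_rpow_neg_one_add_norm_sq (by simp)
  refine (hint.const_mul C).mono'
    ((continuous_one_add_norm_sq_rpow _).mul hf.norm).aestronglyMeasurable
    (Eventually.of_forall fun x => ?_)
  have hx : 0 < 1 + ‖x‖ ^ 2 := by positivity
  rw [Real.norm_of_nonneg (by positivity)]
  calc _ ≤ (1 + ‖x‖ ^ 2) ^ (-((α + (n + 1) : ℕ) : ℝ) / 2) *
        (C * (1 + ‖x‖ ^ 2) ^ ((α : ℝ) / 2)) := by gcongr; exact h x
    _ = C * (1 + ‖x‖ ^ 2) ^ (-((n + 1 : ℕ) : ℝ) / 2) := by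
      rw [mul_left_comm, ← Real.rpow_add hx]
      congr 2
      push_cast
      ring

/-- A smooth function `Φ : ℝⁿ → ℂ` has temperate growth (`Φ ∈ O_M(ℝⁿ)`) if and only if for
every multi-index `β` there is `α ∈ ℕ` such that `∫ (1+|x|²)^{-α/2} |∂^β Φ(x)| dx` is finite. -/
theorem OM_iff_integral_finite (n : ℕ) (Φ : EuclideanSpace ℝ (Fin n) → ℂ)
    (hΦ : ContDiff ℝ (⊤ : ℕ∞) Φ) :
    (∀ β : Fin n → ℕ, ∃ (α : ℕ) (C : ℝ), ∀ x,
        ‖mderiv β Φ x‖ ≤ C * (1 + ‖x‖^2) ^ ((α:ℝ)/2)) ↔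
    (∀ β : Fin n → ℕ, ∃ α : ℕ,
        Integrable (fun x : EuclideanSpace ℝ (Fin n) =>
          (1 + ‖x‖^2) ^ (-(α:ℝ)/2) * ‖mderiv β Φ x‖)) := by
  constructor
  · intro h β
    obtain ⟨α, C, hC⟩ := h β
    exact ⟨_, exists_integrable_of_norm_le (contDiff_mderiv β hΦ).continuous hC⟩
  · intro h β
    refine (HasBoundedWeightedMarginal.empty_of_univ
      (F := Set.range fun β : Fin n → ℕ => mderiv β Φ) ?_ ?_ ?_ _ ⟨β, rfl⟩).exists_norm_le
    · rintro _ ⟨β, rfl⟩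
      exact contDiff_mderiv β hΦ
    · rintro _ ⟨β, rfl⟩ i
      exact ⟨_, (pd_mderiv β i hΦ).symm⟩
    · rintro _ ⟨β, rfl⟩
      obtain ⟨α, hα⟩ := h β
      exact hasBoundedWeightedMarginal_univ hα
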